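/- (Strict Comparison) Let F and G be primitive subequations on an open set U ⊆ ℝⁿ with G ⊆ Int F, where additionally Int F satisfies positivity: (x,r,p,A) ∈ Int F, P ≥ 0 ⇒ (x,r,p,A+P) ∈ Int F, and negativity: (x,r,p,A) ∈ Int F, s ≤ r ⇒ (x,s,p,A) ∈ Int F. Let F̃ denote the dual, F̃ = complement of {(x,-r,-p,-A) : (x,r,p,A) ∈ F}. If u, v : U → ℝ are λ-quasi-convex with u G-subharmonic and v F̃-subharmonic, then for any compact K ⊆ U: u + v ≤ 0 on ∂K implies u + v ≤ 0 on K. -/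

import Mathlib

open scoped RealInnerProductSpace Topology
open Filter MeasureTheory

/-- The quadratic form `⟨A v, v⟩` associated to a matrix `A`. -/
noncomputable def quad {n : ℕ} (A : Matrix (Fin n) (Fin n) ℝ)
    (v : EuclideanSpace ℝ (Fin n)) : ℝ :=
  ∑ i, ∑ j, A i j * v i * v j

/-- `(p, A)` is an upper contact jet for `w` at `x₀`. -/
def UpperContactJet {n : ℕ} (w : EuclideanSpace ℝ (Fin n) → ℝ)
    (x₀ p : EuclideanSpace ℝ (Fin n)) (A : Matrix (Fin n) (Fin n) ℝ) : Prop :=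
  ∀ᶠ y in 𝓝 x₀, w y ≤ w x₀ + ⟪p, y - x₀⟫ + (1 / 2) * quad A (y - x₀)

/-- `w` is twice differentiable at `x` with gradient `g` and Hessian `H`, in the sense of
a second-order Taylor expansion. -/
def TwiceDiffAt {n : ℕ} (w : EuclideanSpace ℝ (Fin n) → ℝ)
    (x g : EuclideanSpace ℝ (Fin n)) (H : Matrix (Fin n) (Fin n) ℝ) : Prop :=
  HasGradientAt w g x ∧
    (fun y => w y - w x - ⟪g, y - x⟫ - (1 / 2) * quad H (y - x)) =o[𝓝 x]
      fun y => ‖y - x‖ ^ 2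

/-- `w` is `lam`-quasi-convex on `U`: `w + (lam/2)|·|²` is convex on `U`. -/
def QCOn {n : ℕ} (lam : ℝ) (U : Set (EuclideanSpace ℝ (Fin n)))
    (w : EuclideanSpace ℝ (Fin n) → ℝ) : Prop :=
  ConvexOn ℝ U (fun x => w x + (lam / 2) * ‖x‖ ^ 2)

/-- The 2-jet space `ℝⁿ × ℝ × ℝⁿ × Sym²(ℝⁿ)` (symmetry imposed separately). -/
abbrev Jet (n : ℕ) :=
  EuclideanSpace ℝ (Fin n) × ℝ × EuclideanSpace ℝ (Fin n) × Matrix (Fin n) (Fin n) ℝ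

/-- Positivity condition (P) for a set of 2-jets. -/
def Positivity {n : ℕ} (F : Set (Jet n)) : Prop :=
  ∀ x : EuclideanSpace ℝ (Fin n), ∀ r : ℝ, ∀ p : EuclideanSpace ℝ (Fin n),
    ∀ A P : Matrix (Fin n) (Fin n) ℝ,
      (x, r, p, A) ∈ F → P.PosSemidef → (x, r, p, A + P) ∈ F

/-- `u` is `F`-subharmonic on `U`: every upper contact jet of `u` at a point of `U`
belongs to `F`. -/
def Subharm {n : ℕ} (F : Set (Jet n)) (U : Set (EuclideanSpace ℝ (Fin n)))
    (u : EuclideanSpace ℝ (Fin n) → ℝ) : Prop :=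
  ∀ x ∈ U, ∀ (p : EuclideanSpace ℝ (Fin n)) (A : Matrix (Fin n) (Fin n) ℝ),
    A.IsSymm → UpperContactJet u x p A → (x, u x, p, A) ∈ F

section Semiconvex

variable {V : Type*} [NormedAddCommGroup V] [InnerProductSpace ℝ V]

/-- `p` is the slope at `x` of a paraboloid of opening `-2 * c` touching `u` from below on `S`. -/
def IsSemiSubgradient (c : ℝ) (S : Set V) (u : V → ℝ) (x p : V) : Prop :=
  ∀ y ∈ S, u x + ⟪p, y - x⟫ - c * ‖y - x‖ ^ 2 ≤ u y

lemma IsSemiSubgradient.mono {c : ℝ} {S T : Set V} {u : V → ℝ} {x p : V}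
    (h : IsSemiSubgradient c T u x p) (hST : S ⊆ T) : IsSemiSubgradient c S u x p :=
  fun y hy => h y (hST hy)

lemma ConvexOn.exists_subgradient [FiniteDimensional ℝ V] {U : Set V} (hU : IsOpen U) {f : V → ℝ}
    (hf : ConvexOn ℝ U f) {x : V} (hx : x ∈ U) :
    ∃ p : V, ∀ y ∈ U, f x + ⟪p, y - x⟫ ≤ f y := by
  have hcont : ContinuousOn f U := hf.continuousOn hU
  have hopen : IsOpen {z : V × ℝ | z.1 ∈ U ∧ f z.1 < z.2} := by
    rw [isOpen_iff_mem_nhds]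
    rintro ⟨y, t⟩ ⟨hy, hyt⟩
    have h1 : ContinuousAt (fun z : V × ℝ => f z.1) (y, t) :=
      ContinuousAt.comp (x := (y, t)) (f := Prod.fst) (g := f)
        (hcont.continuousAt (hU.mem_nhds hy)) continuousAt_fst
    have h2 : ∀ᶠ z : V × ℝ in 𝓝 (y, t), z.1 ∈ U :=
      continuousAt_fst.eventually (hU.mem_nhds hy)
    filter_upwards [h2, h1.eventually_lt continuousAt_snd hyt] with z hz hz' using ⟨hz, hz'⟩
  obtain ⟨L, hL⟩ := geometric_hahn_banach_open_point (x := (x, f x))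
    hf.convex_strict_epigraph hopen (fun h => lt_irrefl _ h.2)
  have hsplit : ∀ (y : V) (t : ℝ), L (y, t) = L (y, 0) + t * L (0, 1) := by
    intro y t
    have : ((y, t) : V × ℝ) = (y, 0) + t • (0, 1) := by simp
    rw [this, map_add, map_smul, smul_eq_mul]
  set c := L (0, 1) with hc
  have hcneg : c < 0 := by
    have := hL (x, f x + 1) ⟨hx, by simp⟩
    rw [hsplit x (f x), hsplit x (f x + 1)] at this
    linarith
  refine ⟨(InnerProductSpace.toDual ℝ V).symm ((-c⁻¹) • L.comp (.inl ℝ V ℝ)), fun y hy => ?_⟩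
  rw [InnerProductSpace.toDual_symm_apply]
  have hle : L (y, 0) + f y * c ≤ L (x, 0) + f x * c := by
    refine le_of_forall_pos_le_add fun ε hε => ?_
    have := hL (y, f y + ε / (-c)) ⟨hy, by
      have : 0 < ε / (-c) := div_pos hε (by linarith)
      simpa using this⟩
    rw [hsplit y, hsplit x (f x)] at this
    have h3 : (f y + ε / (-c)) * c = f y * c - ε := by
      field_simp [hcneg.ne]
      ring
    linarith
  have hsub : L (y - x, 0) = L (y, 0) - L (x, 0) := by
    rw [← map_sub]; simp
  have : ((-c⁻¹) • L.comp (.inl ℝ V ℝ)) (y - x) = (-c⁻¹) * (L (y, 0) - L (x, 0)) := by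
    simp [← hsub]
  rw [this]
  have h4 : (-c⁻¹) * (L (y, 0) - L (x, 0)) ≤ (-c⁻¹) * ((f x - f y) * c) :=
    mul_le_mul_of_nonneg_left (by linarith) (by simpa using hcneg.le)
  have h5 : (-c⁻¹) * ((f x - f y) * c) = f y - f x := by
    field_simp [hcneg.ne]
    ring
  linarith

lemma exists_isSemiSubgradient [FiniteDimensional ℝ V] {U : Set V} (hU : IsOpen U) {u : V → ℝ}
    {lam : ℝ} (hu : ConvexOn ℝ U fun x => u x + (lam / 2) * ‖x‖ ^ 2) {x : V} (hx : x ∈ U) :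
    ∃ p, IsSemiSubgradient (lam / 2) U u x p := by
  obtain ⟨p, hp⟩ := hu.exists_subgradient hU hx
  refine ⟨p - lam • x, fun y hy => ?_⟩
  have h1 := hp y hy
  have h2 : ‖y‖ ^ 2 = ‖x‖ ^ 2 + 2 * ⟪x, y - x⟫ + ‖y - x‖ ^ 2 := by
    rw [← norm_add_sq_real, add_sub_cancel]
  rw [inner_sub_left, real_inner_smul_left]
  simp only [h2] at h1
  linarith

/-- Where `u` is touched from above by a paraboloid, its slopes are Lipschitz. -/
lemma IsSemiSubgradient.norm_slope_sub_le {c C r : ℝ} (hc : 0 ≤ c) (hC : 0 ≤ C) {u : V → ℝ}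
    {p : V → V} {x₀ x w : V}
    (hx : x ∈ Metric.closedBall x₀ (r / 2)) (hw : w ∈ Metric.closedBall x₀ (r / 2))
    (hp : IsSemiSubgradient c (Metric.closedBall x₀ r) u x (p x))
    (hq : IsSemiSubgradient c (Metric.closedBall x₀ r) u w (p w))
    (hup : ∀ y ∈ Metric.closedBall x₀ r, u y ≤ u x + ⟪p x, y - x⟫ + C * ‖y - x‖ ^ 2) :
    ‖p w - p x‖ ≤ (5 * c + 9 * C) * ‖w - x‖ := by
  rw [mem_closedBall_iff_norm] at hx hw
  have hwx : ‖w - x‖ ≤ r := by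
    have := norm_sub_le (w - x₀) (x - x₀)
    rw [sub_sub_sub_cancel_right] at this
    linarith
  rcases eq_or_ne (p w) (p x) with heq | hne
  · rw [heq, sub_self, norm_zero]; positivity
  have hD : 0 < ‖p w - p x‖ := norm_pos_iff.2 (sub_ne_zero.2 hne)
  obtain ⟨t, ht⟩ : ∃ t, t = ‖w - x‖ / 2 := ⟨_, rfl⟩
  have ht0 : 0 ≤ t := by rw [ht]; positivity
  obtain ⟨e, he⟩ : ∃ e, e = (t / ‖p w - p x‖) • (p w - p x) := ⟨_, rfl⟩
  have hen : ‖e‖ = t := by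
    rw [he, norm_smul, Real.norm_of_nonneg (by positivity)]
    field_simp
  have hine : ⟪p w, e⟫ - ⟪p x, e⟫ = t * ‖p w - p x‖ := by
    rw [← inner_sub_left, he, inner_smul_right, real_inner_self_eq_norm_sq]
    field_simp
  have hmem : w + e ∈ Metric.closedBall x₀ r := by
    rw [mem_closedBall_iff_norm]
    have := norm_add_le (w - x₀) e
    rw [sub_add_eq_add_sub] at this
    linarith
  have hwm : w ∈ Metric.closedBall x₀ r := by
    rw [mem_closedBall_iff_norm]
    have := norm_nonneg (w - x₀)
    linarith
  have h1 := hq _ hmem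
  have h2 := hup _ hmem
  have h3 := hp w hwm
  rw [add_sub_cancel_left] at h1
  have h4 : w + e - x = (w - x) + e := by abel
  rw [h4, inner_add_right] at h2
  have h5 : ‖w - x + e‖ ^ 2 ≤ (3 * t) ^ 2 := by
    have := norm_add_le (w - x) e
    gcongr
    linarith
  have h6 : C * ‖w - x + e‖ ^ 2 ≤ C * (3 * t) ^ 2 := by gcongr
  have h7 : ‖w - x‖ = 2 * t := by linarith
  rw [h7] at h3 ⊢
  rw [hen] at h1
  have h8 : t * ‖p w - p x‖ ≤ t * ((5 * c + 9 * C) * t) := by nlinarith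
  have h0 : 0 < t := by
    refine ht0.lt_of_ne fun h0 => hne ?_
    rw [← h0, mul_zero, norm_eq_zero, sub_eq_zero] at h7
    rw [h7]
  have h9 := le_of_mul_le_mul_left h8 h0
  nlinarith [mul_nonneg (by positivity : 0 ≤ 5 * c + 9 * C) ht0]

lemma eq_zero_of_inner_le_sq {C r : ℝ} {x₀ x a : V} (hx : x ∈ Metric.ball x₀ r)
    (h : ∀ y ∈ Metric.closedBall x₀ r, ⟪a, y - x⟫ ≤ C * ‖y - x‖ ^ 2) : a = 0 := by
  by_contra ha
  have hsq : 0 < ‖a‖ ^ 2 := by positivity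
  have hlim : Tendsto (fun t : ℝ => C * t) (𝓝[>] 0) (𝓝 0) := by
    have : Tendsto (fun t : ℝ => C * t) (𝓝 0) (𝓝 (C * 0)) := tendsto_id.const_mul C
    rw [mul_zero] at this
    exact this.mono_left nhdsWithin_le_nhds
  have hmem : ∀ᶠ t : ℝ in 𝓝[>] 0, x + t • a ∈ Metric.closedBall x₀ r := by
    have h1 : Tendsto (fun t : ℝ => x + t • a) (𝓝 0) (𝓝 (x + (0 : ℝ) • a)) := by
      apply Continuous.tendsto; fun_prop
    rw [zero_smul, add_zero] at h1
    exact (h1.mono_left nhdsWithin_le_nhds).eventually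
      (mem_of_superset (Metric.isOpen_ball.mem_nhds hx) Metric.ball_subset_closedBall)
  obtain ⟨t, h1, h2, h3⟩ :=
    ((hlim.eventually_lt_const one_pos).and (hmem.and self_mem_nhdsWithin)).exists
  have h4 := h _ h2
  rw [add_sub_cancel_left, inner_smul_right, real_inner_self_eq_norm_sq, norm_smul,
    Real.norm_of_nonneg (le_of_lt h3), mul_pow] at h4
  have h5 : (0 : ℝ) < t * ‖a‖ ^ 2 := mul_pos h3 hsq
  nlinarith

/-- At a point where `u + v` is touched from above by a paraboloid, the slopes of `u` and `v`
add up to the slope of the paraboloid. -/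
lemma slope_add_eq_of_contact {c δ r : ℝ} {u v : V → ℝ} {x₀ x p q s : V}
    (hx : x ∈ Metric.ball x₀ r)
    (hp : IsSemiSubgradient c (Metric.closedBall x₀ r) u x p)
    (hq : IsSemiSubgradient c (Metric.closedBall x₀ r) v x q)
    (hs : ∀ y ∈ Metric.closedBall x₀ r,
      u y + v y - δ * ‖y - x₀‖ ^ 2 - ⟪s, y - x⟫ ≤ u x + v x - δ * ‖x - x₀‖ ^ 2) :
    p + q - (2 * δ) • (x - x₀) - s = 0 := by
  refine eq_zero_of_inner_le_sq (C := 2 * c + δ) hx fun y hy => ?_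
  have h1 := hp y hy
  have h2 := hq y hy
  have h3 := hs y hy
  have h4 : ‖y - x₀‖ ^ 2 = ‖x - x₀‖ ^ 2 + 2 * ⟪x - x₀, y - x⟫ + ‖y - x‖ ^ 2 := by
    rw [← norm_add_sq_real]; congr 2; abel
  rw [h4] at h3
  rw [inner_sub_left, inner_sub_left, inner_add_left, real_inner_smul_left]
  linarith

lemma le_paraboloid_of_contact {c δ r : ℝ} {u v : V → ℝ} {x₀ x p q s : V}
    (hx : x ∈ Metric.ball x₀ r)
    (hp : IsSemiSubgradient c (Metric.closedBall x₀ r) u x p)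
    (hq : IsSemiSubgradient c (Metric.closedBall x₀ r) v x q)
    (hs : ∀ y ∈ Metric.closedBall x₀ r,
      u y + v y - δ * ‖y - x₀‖ ^ 2 - ⟪s, y - x⟫ ≤ u x + v x - δ * ‖x - x₀‖ ^ 2) :
    ∀ y ∈ Metric.closedBall x₀ r, u y ≤ u x + ⟪p, y - x⟫ + (c + δ) * ‖y - x‖ ^ 2 := by
  intro y hy
  have h0 := slope_add_eq_of_contact hx hp hq hs
  have h2 := hq y hy
  have h3 := hs y hy
  have h4 : ‖y - x₀‖ ^ 2 = ‖x - x₀‖ ^ 2 + 2 * ⟪x - x₀, y - x⟫ + ‖y - x‖ ^ 2 := by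
    rw [← norm_add_sq_real]; congr 2; abel
  have h5 : ⟪p, y - x⟫ + ⟪q, y - x⟫ - 2 * δ * ⟪x - x₀, y - x⟫ - ⟪s, y - x⟫ = 0 := by
    rw [← inner_add_left, ← real_inner_smul_left, ← inner_sub_left, ← inner_sub_left, h0,
      inner_zero_left]
  rw [h4] at h3
  linarith

lemma abs_sub_le_of_abs_sub_le_add_sq {φ : ℝ → ℝ} {b C : ℝ}
    (h : ∀ t t', 0 ≤ t → t ≤ t' → t' ≤ 1 → |φ t' - φ t| ≤ b * (t' - t) + C * (t' - t) ^ 2) :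
    |φ 1 - φ 0| ≤ b := by
  have key : ∀ N : ℕ, |φ 1 - φ 0| ≤ b + C / (N + 1) := by
    intro N
    have hN : (0 : ℝ) < N + 1 := by positivity
    have hk : ∀ k : ℕ, k ≤ N + 1 →
        |φ (k / (N + 1)) - φ 0| ≤ k * (b / (N + 1) + C / (N + 1) ^ 2) := by
      intro k
      induction k with
      | zero => simp
      | succ k ih =>
        intro hk
        have h1 := ih (by omega)
        have hk' : ((k + 1 : ℕ) : ℝ) ≤ N + 1 := by exact_mod_cast hk
        have h2 := h (k / (N + 1)) ((k + 1 : ℕ) / (N + 1)) (by positivity)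
          (by gcongr; simp) ((div_le_one hN).2 hk')
        have h3 : ((k + 1 : ℕ) : ℝ) / (N + 1) - k / (N + 1) = 1 / (N + 1) := by
          push_cast; ring
        rw [h3] at h2
        have h4 := abs_sub_le (φ ((k + 1 : ℕ) / (N + 1))) (φ (k / (N + 1))) (φ 0)
        have h5 : b * (1 / (N + 1)) + C * (1 / ((N : ℝ) + 1)) ^ 2
            = b / (N + 1) + C / (N + 1) ^ 2 := by field_simp
        push_cast at h4 h2 ⊢
        linarith
    have h1 := hk (N + 1) le_rfl
    push_cast at h1
    rw [div_self hN.ne'] at h1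
    refine h1.trans (le_of_eq ?_)
    field_simp
  have hlim : Tendsto (fun N : ℕ => b + C / ((N : ℝ) + 1)) atTop (𝓝 (b + 0)) :=
    tendsto_const_nhds.add
      (tendsto_const_nhds.div_atTop (tendsto_atTop_add_const_right _ _ tendsto_natCast_atTop_atTop))
  rw [add_zero] at hlim
  exact ge_of_tendsto' hlim key

/-- A semiconvex function has a second-order Taylor expansion at every point where its slope is
differentiable. -/
lemma taylor_of_hasFDerivAt_slope {c : ℝ} {S : Set V} {u : V → ℝ} {p : V → V} {x : V}
    (hS : S ∈ 𝓝 x) (hsub : ∀ w ∈ S, IsSemiSubgradient c S u w (p w)) {A : V →L[ℝ] V}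
    (hA : HasFDerivAt p A x) {η : ℝ} (hη : 0 < η) :
    ∀ᶠ y in 𝓝 x,
      |u y - u x - ⟪p x, y - x⟫ - 1 / 2 * ⟪A (y - x), y - x⟫| ≤ η * ‖y - x‖ ^ 2 := by
  obtain ⟨ρ, hρ, hball⟩ := Metric.mem_nhds_iff.1 (inter_mem hS (hA.isLittleO.def hη))
  filter_upwards [Metric.ball_mem_nhds x hρ] with y hy
  obtain ⟨h, hh⟩ : ∃ h, h = y - x := ⟨_, rfl⟩
  have hseg : ∀ t : ℝ, 0 ≤ t → t ≤ 1 → x + t • h ∈ Metric.ball x ρ := by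
    intro t h0 h1
    rw [mem_ball_iff_norm] at hy ⊢
    rw [add_sub_cancel_left, norm_smul, Real.norm_of_nonneg h0, hh]
    nlinarith [norm_nonneg (y - x)]
  have hslope : ∀ t : ℝ, 0 ≤ t → t ≤ 1 →
      |⟪p (x + t • h), h⟫ - ⟪p x, h⟫ - t * ⟪A h, h⟫| ≤ η * ‖h‖ ^ 2 := by
    intro t h0 h1
    have h2 : ‖p (x + t • h) - p x - A (x + t • h - x)‖ ≤ η * ‖x + t • h - x‖ :=
      (hball (hseg t h0 h1)).2
    rw [add_sub_cancel_left, norm_smul, Real.norm_of_nonneg h0, map_smul] at h2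
    have h3 := abs_real_inner_le_norm (p (x + t • h) - p x - t • A h) h
    rw [inner_sub_left, inner_sub_left, real_inner_smul_left] at h3
    have h4 : η * (t * ‖h‖) ≤ η * (1 * ‖h‖) := by gcongr
    calc _ ≤ _ := h3
      _ ≤ (η * (1 * ‖h‖)) * ‖h‖ := by gcongr; exact h2.trans h4
      _ = _ := by ring
  have hinc : ∀ t t' : ℝ, 0 ≤ t → t ≤ 1 → 0 ≤ t' → t' ≤ 1 →
      u (x + t • h) + (t' - t) * ⟪p (x + t • h), h⟫ - c * ((t' - t) ^ 2 * ‖h‖ ^ 2)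
        ≤ u (x + t' • h) := by
    intro t t' h0 h1 h0' h1'
    have h2 := hsub _ (hball (hseg t h0 h1)).1 _ (hball (hseg t' h0' h1')).1
    have h3 : x + t' • h - (x + t • h) = (t' - t) • h := by
      rw [sub_smul]; abel
    rw [h3, inner_smul_right, norm_smul, mul_pow, Real.norm_eq_abs, sq_abs] at h2
    exact h2
  have hmain := abs_sub_le_of_abs_sub_le_add_sq
    (φ := fun t => u (x + t • h) - t * ⟪p x, h⟫ - 1 / 2 * t ^ 2 * ⟪A h, h⟫)
    (b := η * ‖h‖ ^ 2) (C := c * ‖h‖ ^ 2 + 1 / 2 * |⟪A h, h⟫|) (by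
      intro t t' h0 htt h1
      have hd : 0 ≤ t' - t := sub_nonneg.2 htt
      have e1 := hinc t t' h0 (htt.trans h1) (h0.trans htt) h1
      have e2 := hinc t' t (h0.trans htt) h1 h0 (htt.trans h1)
      have s1 := mul_le_mul_of_nonneg_left (abs_le.1 (hslope t h0 (htt.trans h1))).1 hd
      have s2 := mul_le_mul_of_nonneg_left (abs_le.1 (hslope t' (h0.trans htt) h1)).2 hd
      have a1 := mul_le_mul_of_nonneg_left (le_abs_self ⟪A h, h⟫) (sq_nonneg (t' - t))
      have a2 := mul_le_mul_of_nonneg_left (neg_abs_le ⟪A h, h⟫) (sq_nonneg (t' - t))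
      rw [abs_le]
      constructor
      · linarith
      · linarith)
  have hxy : x + h = y := by rw [hh]; abel
  simp only [one_smul, hxy, zero_smul, add_zero, ← hh] at hmain ⊢
  convert hmain using 2
  ring

/-- A map that is Lipschitz towards `E`, differentiable within `E` at `x`, is differentiable at `x`
as soon as the distance to `E` is. -/
lemma HasFDerivWithinAt.hasFDerivAt_of_infDist {E : Set V} {p : V → V} {x : V} (hx : x ∈ E)
    {L : ℝ} (hL : 0 ≤ L) (hp : ∀ᶠ w in 𝓝 x, ∀ z ∈ E, ‖p w - p z‖ ≤ L * ‖w - z‖)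
    (hd : DifferentiableAt ℝ (fun y => Metric.infDist y E) x) {A : V →L[ℝ] V}
    (hA : HasFDerivWithinAt p A E x) : HasFDerivAt p A x := by
  have hd0 : HasFDerivAt (fun y => Metric.infDist y E) (0 : V →L[ℝ] ℝ) x := by
    have hmin : IsLocalMin (fun y => Metric.infDist y E) x := by
      refine Filter.Eventually.of_forall fun y => ?_
      simp only [Metric.infDist_zero_of_mem hx]
      exact Metric.infDist_nonneg
    have := hd.hasFDerivAt
    rwa [hmin.hasFDerivAt_eq_zero this] at this
  rw [hasFDerivAt_iff_isLittleO, Asymptotics.isLittleO_iff]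
  intro ε hε
  have hM : 0 < L + 2 + ‖A‖ := by positivity
  obtain ⟨η, hη0, hη1, hηε⟩ : ∃ η : ℝ, 0 < η ∧ η ≤ 1 ∧ η * (L + 2 + ‖A‖) ≤ ε := by
    refine ⟨min 1 (ε / (L + 2 + ‖A‖)), by positivity, min_le_left _ _, ?_⟩
    calc _ ≤ ε / (L + 2 + ‖A‖) * (L + 2 + ‖A‖) := by gcongr; exact min_le_right _ _
      _ = ε := by field_simp
  have hd1 := hd0.isLittleO.def (half_pos hη0)
  have hA1 := hA.isLittleO.def hη0
  rw [eventually_nhdsWithin_iff, Metric.eventually_nhds_iff] at hA1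
  obtain ⟨ρ, hρ, hA2⟩ := hA1
  filter_upwards [hp, hd1, Metric.ball_mem_nhds x (half_pos hρ)] with w hw1 hw2 hw3
  rcases eq_or_ne w x with rfl | hne
  · simp
  have hpos : 0 < ‖w - x‖ := norm_pos_iff.2 (sub_ne_zero.2 hne)
  simp only [Metric.infDist_zero_of_mem hx, sub_zero, zero_apply,
    Real.norm_of_nonneg Metric.infDist_nonneg] at hw2
  have hlt : Metric.infDist w E < η * ‖w - x‖ := by nlinarith
  obtain ⟨z, hz, hwz⟩ := (Metric.infDist_lt_iff ⟨x, hx⟩).1 hlt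
  rw [dist_eq_norm] at hwz
  rw [mem_ball_iff_norm] at hw3
  have hzx : ‖z - x‖ ≤ 2 * ‖w - x‖ := by
    have := norm_sub_le (w - x) (w - z)
    rw [sub_sub_sub_cancel_left] at this
    nlinarith
  have h1 := hw1 z hz
  have h2 := hA2 (y := z) (by rw [dist_eq_norm]; linarith) hz
  have h3 := A.le_opNorm (z - w)
  rw [norm_sub_rev z w] at h3
  have heq : p w - p x - A (w - x) = (p w - p z) + (p z - p x - A (z - x)) + A (z - w) := by
    simp only [map_sub]; abel
  rw [heq]
  calc _ ≤ ‖p w - p z‖ + ‖p z - p x - A (z - x)‖ + ‖A (z - w)‖ := norm_add₃_le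
    _ ≤ L * (η * ‖w - x‖) + η * (2 * ‖w - x‖) + ‖A‖ * (η * ‖w - x‖) := by
        gcongr
        · exact h1.trans (by gcongr)
        · exact h2.trans (by gcongr)
        · exact h3.trans (by gcongr)
    _ = η * (L + 2 + ‖A‖) * ‖w - x‖ := by ring
    _ ≤ ε * ‖w - x‖ := by gcongr

/-- If a Lipschitz map sends `E` onto a set with nonempty interior, then `E` contains common
differentiability points of Lipschitz maps. -/
lemma exists_differentiable_point [FiniteDimensional ℝ V] {E : Set V} {p q s : V → V} {C : NNReal}
    (hp : LipschitzOnWith C p E) (hq : LipschitzOnWith C q E) {D : NNReal}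
    (hs : LipschitzOnWith D s E) {ρ : ℝ} (hρ : 0 < ρ) (hsurj : Metric.ball 0 ρ ⊆ s '' E) :
    ∃ x ∈ E, DifferentiableWithinAt ℝ p E x ∧ DifferentiableWithinAt ℝ q E x ∧
      DifferentiableAt ℝ (fun y => Metric.infDist y E) x := by
  borelize V
  let μ : Measure V := Measure.hausdorffMeasure (Module.finrank ℝ V : ℝ)
  have hE : μ E ≠ 0 := by
    intro h0
    have h1 : μ (Metric.ball 0 ρ) ≤ 0 := by
      calc μ (Metric.ball 0 ρ) ≤ μ (s '' E) := measure_mono hsurj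
        _ ≤ D ^ (Module.finrank ℝ V : ℝ) * μ E := hs.hausdorffMeasure_image_le (by positivity)
        _ = 0 := by rw [h0, mul_zero]
    exact (Metric.measure_ball_pos μ 0 hρ).not_ge h1
  by_contra! hcon
  refine hE ?_
  have hae : ∀ᵐ x ∂μ, x ∉ E := by
    filter_upwards [hp.ae_differentiableWithinAt_of_mem (μ := μ),
      hq.ae_differentiableWithinAt_of_mem (μ := μ),
      (Metric.lipschitz_infDist_pt E).ae_differentiableAt (μ := μ)] with x h1 h2 h3 hx
    exact hcon x hx (h1 hx) (h2 hx) h3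
  rw [ae_iff] at hae
  simpa using hae

lemma inner_map_self_le_of_eventually {A : V →L[ℝ] V} {b : ℝ} {x : V}
    (h : ∀ᶠ y in 𝓝 x, ⟪A (y - x), y - x⟫ ≤ b * ‖y - x‖ ^ 2) (k : V) :
    ⟪A k, k⟫ ≤ b * ‖k‖ ^ 2 := by
  have h1 : Tendsto (fun t : ℝ => x + t • k) (𝓝[>] 0) (𝓝 x) := by
    have h1 : Tendsto (fun t : ℝ => x + t • k) (𝓝 0) (𝓝 (x + (0 : ℝ) • k)) := by
      apply Continuous.tendsto; fun_prop
    rw [zero_smul, add_zero] at h1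
    exact h1.mono_left nhdsWithin_le_nhds
  obtain ⟨t, h2, h3⟩ := ((h1.eventually h).and self_mem_nhdsWithin).exists
  have ht : (0 : ℝ) < t := h3
  rw [add_sub_cancel_left, map_smul, inner_smul_right, real_inner_smul_left, norm_smul,
    Real.norm_of_nonneg ht.le] at h2
  have ht2 : 0 < t ^ 2 := by positivity
  refine le_of_mul_le_mul_left ?_ ht2
  linarith

/-- A function with a second-order Taylor expansion at `x`. -/
def HasTaylorAt (u : V → ℝ) (x p : V) (A : V →L[ℝ] V) : Prop :=
  ∀ η : ℝ, 0 < η → ∀ᶠ y in 𝓝 x,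
    |u y - u x - ⟪p, y - x⟫ - 1 / 2 * ⟪A (y - x), y - x⟫| ≤ η * ‖y - x‖ ^ 2

lemma HasTaylorAt.neg_le_inner_map_self {u : V → ℝ} {x p : V} {A : V →L[ℝ] V} {c : ℝ} {S : Set V}
    (hu : HasTaylorAt u x p A) (hS : S ∈ 𝓝 x) (hp : IsSemiSubgradient c S u x p) (k : V) :
    -(2 * c) * ‖k‖ ^ 2 ≤ ⟪A k, k⟫ := by
  refine le_of_forall_pos_le_add fun ε hε => ?_
  obtain ⟨η, hη, hηε⟩ : ∃ η : ℝ, 0 < η ∧ 2 * η * ‖k‖ ^ 2 ≤ ε := by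
    refine ⟨ε / (2 * (‖k‖ ^ 2 + 1)), by positivity, ?_⟩
    calc _ = ε * (‖k‖ ^ 2 / (‖k‖ ^ 2 + 1)) := by field_simp
      _ ≤ ε * 1 := by gcongr; rw [div_le_one (by positivity)]; linarith
      _ = ε := mul_one ε
  have := inner_map_self_le_of_eventually (A := -A) (b := 2 * c + 2 * η) (x := x) (by
    filter_upwards [hu η hη, hS] with y hy hyS
    have h1 := hp y hyS
    have h2 := (abs_le.1 hy).2
    rw [neg_apply, inner_neg_left]
    linarith) k
  rw [neg_apply, inner_neg_left] at this
  linarith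

lemma HasTaylorAt.inner_map_self_add_le {u v : V → ℝ} {x x₀ p q s : V} {A B : V →L[ℝ] V} {δ : ℝ}
    {S : Set V} (hu : HasTaylorAt u x p A) (hv : HasTaylorAt v x q B) (hS : S ∈ 𝓝 x)
    (h0 : p + q - (2 * δ) • (x - x₀) - s = 0)
    (hs : ∀ y ∈ S,
      u y + v y - δ * ‖y - x₀‖ ^ 2 - ⟪s, y - x⟫ ≤ u x + v x - δ * ‖x - x₀‖ ^ 2) (k : V) :
    ⟪A k, k⟫ + ⟪B k, k⟫ ≤ 2 * δ * ‖k‖ ^ 2 := by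
  refine le_of_forall_pos_le_add fun ε hε => ?_
  obtain ⟨η, hη, hηε⟩ : ∃ η : ℝ, 0 < η ∧ 4 * η * ‖k‖ ^ 2 ≤ ε := by
    refine ⟨ε / (4 * (‖k‖ ^ 2 + 1)), by positivity, ?_⟩
    calc _ = ε * (‖k‖ ^ 2 / (‖k‖ ^ 2 + 1)) := by field_simp
      _ ≤ ε * 1 := by gcongr; rw [div_le_one (by positivity)]; linarith
      _ = ε := mul_one ε
  have := inner_map_self_le_of_eventually (A := A + B) (b := 2 * δ + 4 * η) (x := x) (by
    filter_upwards [hu η hη, hv η hη, hS] with y hy hy' hyS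
    have h1 := (abs_le.1 hy).1
    have h2 := (abs_le.1 hy').1
    have h3 := hs y hyS
    have h4 : ‖y - x₀‖ ^ 2 = ‖x - x₀‖ ^ 2 + 2 * ⟪x - x₀, y - x⟫ + ‖y - x‖ ^ 2 := by
      rw [← norm_add_sq_real]; congr 2; abel
    have h5 : ⟪p, y - x⟫ + ⟪q, y - x⟫ - 2 * δ * ⟪x - x₀, y - x⟫ - ⟪s, y - x⟫ = 0 := by
      rw [← inner_add_left, ← real_inner_smul_left, ← inner_sub_left, ← inner_sub_left, h0,
        inner_zero_left]
    rw [h4] at h3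
    rw [add_apply, inner_add_left]
    linarith) k
  rw [add_apply, inner_add_left] at this
  linarith

/-- Near a local maximum of the sum of two semiconvex functions there are points at which both have
second-order Taylor expansions whose Hessians have an almost nonpositive sum. -/
lemma exists_hasTaylorAt_near_max [FiniteDimensional ℝ V] {c r δ : ℝ} (hc : 0 ≤ c) (hr : 0 < r)
    (hδ : 0 < δ) (hδ1 : δ ≤ 1) {u v : V → ℝ} {p q : V → V} {x₀ : V}
    (hu : ContinuousOn u (Metric.closedBall x₀ r)) (hv : ContinuousOn v (Metric.closedBall x₀ r))
    (hp : ∀ w ∈ Metric.closedBall x₀ r, IsSemiSubgradient c (Metric.closedBall x₀ r) u w (p w))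
    (hq : ∀ w ∈ Metric.closedBall x₀ r, IsSemiSubgradient c (Metric.closedBall x₀ r) v w (q w))
    (hmax : ∀ y ∈ Metric.closedBall x₀ r, u y + v y ≤ u x₀ + v x₀) :
    ∃ x ∈ Metric.ball x₀ (r / 2), ∃ A B : V →L[ℝ] V,
      HasTaylorAt u x (p x) A ∧ HasTaylorAt v x (q x) B ∧
      ‖p x - p x₀‖ ≤ (14 * c + 9) * ‖x - x₀‖ ∧ ‖q x + p x₀‖ ≤ (14 * c + 9) * ‖x - x₀‖ ∧
      (∀ k, ⟪A k, k⟫ + ⟪B k, k⟫ ≤ 2 * δ * ‖k‖ ^ 2) ∧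
      (∀ k, -(2 * c) * ‖k‖ ^ 2 ≤ ⟪A k, k⟫) ∧ ∀ k, -(2 * c) * ‖k‖ ^ 2 ≤ ⟪B k, k⟫ := by
  set S := Metric.closedBall x₀ r with hSdef
  set T := Metric.ball x₀ (r / 2) with hTdef
  have hTS : T ⊆ S := Metric.ball_subset_closedBall.trans
    (Metric.closedBall_subset_closedBall (by linarith))
  have hT' : T ⊆ Metric.ball x₀ r := Metric.ball_subset_ball (by linarith)
  let s : V → V := fun x => p x + q x - (2 * δ) • (x - x₀)
  let E : Set V := {x | x ∈ T ∧ ∀ y ∈ S,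
    u y + v y - δ * ‖y - x₀‖ ^ 2 - ⟪s x, y - x⟫ ≤ u x + v x - δ * ‖x - x₀‖ ^ 2}
  set L : ℝ := 14 * c + 9 with hL
  have hL0 : 0 ≤ L := by positivity
  have hcontact : ∀ x ∈ T, ∀ a : V, (∀ y ∈ S,
      u y + v y - δ * ‖y - x₀‖ ^ 2 - ⟪a, y - x⟫ ≤ u x + v x - δ * ‖x - x₀‖ ^ 2) →
      x ∈ E ∧ s x = a := by
    intro x hx a ha
    have h1 : s x - a = 0 :=
      slope_add_eq_of_contact (hT' hx) (hp x (hTS hx)) (hq x (hTS hx)) ha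
    have h2 := sub_eq_zero.1 h1
    exact ⟨⟨hx, by rw [h2]; exact ha⟩, h2⟩
  have hx₀ : x₀ ∈ E ∧ s x₀ = 0 := by
    refine hcontact x₀ (Metric.mem_ball_self (half_pos hr)) 0 fun y hy => ?_
    have := hmax y hy
    rw [inner_zero_left, sub_self, norm_zero]
    have : 0 ≤ δ * ‖y - x₀‖ ^ 2 := by positivity
    linarith
  have hq₀ : q x₀ = -p x₀ := by
    have := hx₀.2
    simp only [s, sub_self, smul_zero, sub_zero] at this
    exact (neg_eq_of_add_eq_zero_right this).symm
  have hTc : T ⊆ Metric.closedBall x₀ (r / 2) := Metric.ball_subset_closedBall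
  have hLbound : 5 * c + 9 * (c + δ) ≤ L := by rw [hL]; linarith
  have hpL : ∀ w ∈ T, ∀ z ∈ E, ‖p w - p z‖ ≤ L * ‖w - z‖ := by
    intro w hw z hz
    refine (IsSemiSubgradient.norm_slope_sub_le hc (by linarith) (hTc hz.1) (hTc hw)
      (hp z (hTS hz.1)) (hp w (hTS hw)) (le_paraboloid_of_contact (hT' hz.1)
        (hp z (hTS hz.1)) (hq z (hTS hz.1)) hz.2)).trans ?_
    gcongr
  have hqL : ∀ w ∈ T, ∀ z ∈ E, ‖q w - q z‖ ≤ L * ‖w - z‖ := by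
    intro w hw z hz
    refine (IsSemiSubgradient.norm_slope_sub_le hc (by linarith) (hTc hz.1) (hTc hw)
      (hq z (hTS hz.1)) (hq w (hTS hw)) (le_paraboloid_of_contact (v := u) (hT' hz.1)
        (hq z (hTS hz.1)) (hp z (hTS hz.1)) (s := s z) fun y hy => ?_)).trans ?_
    · have := hz.2 y hy
      linarith
    · gcongr
  have hpE : LipschitzOnWith ⟨L, hL0⟩ p E := LipschitzOnWith.of_dist_le_mul fun x hx y hy => by
    rw [dist_eq_norm, dist_eq_norm]; exact hpL x hx.1 y hy
  have hqE : LipschitzOnWith ⟨L, hL0⟩ q E := LipschitzOnWith.of_dist_le_mul fun x hx y hy => by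
    rw [dist_eq_norm, dist_eq_norm]; exact hqL x hx.1 y hy
  have hsE : LipschitzOnWith ⟨2 * L + 2 * δ, by positivity⟩ s E :=
    LipschitzOnWith.of_dist_le_mul fun x hx y hy => by
      have h1 := hpL x hx.1 y hy
      have h2 := hqL x hx.1 y hy
      have h3 : s x - s y = (p x - p y) + (q x - q y) + (-(2 * δ)) • (x - y) := by
        simp only [s]; module
      have h4 : ‖(-(2 * δ)) • (x - y)‖ = 2 * δ * ‖x - y‖ := by
        rw [norm_smul, norm_neg, Real.norm_of_nonneg (by positivity)]
      have h5 := norm_add₃_le (a := p x - p y) (b := q x - q y) (c := (-(2 * δ)) • (x - y))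
      rw [dist_eq_norm, dist_eq_norm, h3]
      change _ ≤ (2 * L + 2 * δ) * ‖x - y‖
      linarith
  have hsurj : Metric.ball 0 (δ * r / 2) ⊆ s '' E := by
    intro a ha
    rw [mem_ball_zero_iff] at ha
    have hcont : ContinuousOn (fun y => u y + v y - δ * ‖y - x₀‖ ^ 2 - ⟪a, y - x₀⟫) S :=
      ((hu.add hv).sub (by fun_prop)).sub (by fun_prop)
    obtain ⟨x, hxS, hx⟩ := (isCompact_closedBall x₀ r).exists_isMaxOn
      ⟨x₀, Metric.mem_closedBall_self hr.le⟩ hcont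
    have hx' : ∀ y ∈ S, u y + v y - δ * ‖y - x₀‖ ^ 2 - ⟪a, y - x₀⟫
      ≤ u x + v x - δ * ‖x - x₀‖ ^ 2 - ⟪a, x - x₀⟫ := fun y hy => hx hy
    have h1 := hx' x₀ (Metric.mem_closedBall_self hr.le)
    have h2 := hmax x hxS
    simp only [sub_self, norm_zero, inner_zero_right] at h1
    have h3 := (abs_le.1 (abs_real_inner_le_norm a (x - x₀))).1
    have hxT : x ∈ T := by
      rw [hTdef, mem_ball_iff_norm]
      by_contra! hge
      have h4 : 0 < ‖x - x₀‖ := lt_of_lt_of_le (half_pos hr) hge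
      have h5 : ‖a‖ < δ * ‖x - x₀‖ := by nlinarith
      nlinarith
    obtain ⟨h6, h7⟩ := hcontact x hxT a fun y hy => by
      have h8 : y - x = (y - x₀) - (x - x₀) := by abel
      have := hx' y hy
      rw [h8, inner_sub_right]
      linarith
    exact ⟨x, h6, h7⟩
  obtain ⟨x, hxE, hdp, hdq, hdist⟩ :=
    exists_differentiable_point hpE hqE hsE (by positivity) hsurj
  have hTn : T ∈ 𝓝 x := Metric.isOpen_ball.mem_nhds hxE.1
  have hSn : S ∈ 𝓝 x := mem_of_superset hTn hTS
  have hA := hdp.hasFDerivWithinAt.hasFDerivAt_of_infDist hxE hL0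
    (by filter_upwards [hTn] with w hw using hpL w hw) hdist
  have hB := hdq.hasFDerivWithinAt.hasFDerivAt_of_infDist hxE hL0
    (by filter_upwards [hTn] with w hw using hqL w hw) hdist
  have hTu : HasTaylorAt u x (p x) _ := fun η hη => taylor_of_hasFDerivAt_slope hSn hp hA hη
  have hTv : HasTaylorAt v x (q x) _ := fun η hη => taylor_of_hasFDerivAt_slope hSn hq hB hη
  refine ⟨x, hxE.1, _, _, hTu, hTv, hpL x hxE.1 x₀ hx₀.1, ?_, ?_, ?_, ?_⟩
  · have := hqL x hxE.1 x₀ hx₀.1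
    rwa [hq₀, sub_neg_eq_add] at this
  · exact hTu.inner_map_self_add_le hTv hSn (sub_self (s x)) hxE.2
  · exact hTu.neg_le_inner_map_self hSn (hp x (hTS hxE.1))
  · exact hTv.neg_le_inner_map_self hSn (hq x (hTS hxE.1))

end Semiconvex

section Matrices

variable {n : ℕ}

/-- The symmetric matrix of the quadratic form `⟪A v, v⟫`. -/
noncomputable def symMatrix (A : EuclideanSpace ℝ (Fin n) →L[ℝ] EuclideanSpace ℝ (Fin n)) :
    Matrix (Fin n) (Fin n) ℝ :=
  fun i j => (A (EuclideanSpace.single i 1) j + A (EuclideanSpace.single j 1) i) / 2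

lemma isSymm_symMatrix (A : EuclideanSpace ℝ (Fin n) →L[ℝ] EuclideanSpace ℝ (Fin n)) :
    (symMatrix A).IsSymm := by
  ext i j
  simp only [Matrix.transpose_apply, symMatrix]
  ring

lemma quad_symMatrix (A : EuclideanSpace ℝ (Fin n) →L[ℝ] EuclideanSpace ℝ (Fin n))
    (h : EuclideanSpace ℝ (Fin n)) : quad (symMatrix A) h = ⟪A h, h⟫ := by
  have hA : ∀ i, A h i = ∑ j, h j * A (EuclideanSpace.single j 1) i := by
    intro i
    have hh : h = ∑ j, h j • EuclideanSpace.single j (1 : ℝ) := by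
      ext k
      simp [Finset.sum_apply, Pi.single_apply]
    conv_lhs => rw [hh, map_sum]
    simp
  have h1 : ⟪A h, h⟫ = ∑ i, ∑ j, A (EuclideanSpace.single j 1) i * h i * h j := by
    simp only [PiLp.inner_apply, hA]
    refine Finset.sum_congr rfl fun i _ => ?_
    simp only [RCLike.inner_apply, conj_trivial, Finset.mul_sum]
    exact Finset.sum_congr rfl fun j _ => by ring
  have h2 : ⟪A h, h⟫ = ∑ i, ∑ j, A (EuclideanSpace.single i 1) j * h i * h j := by
    rw [h1, Finset.sum_comm]
    exact Finset.sum_congr rfl fun i _ => Finset.sum_congr rfl fun j _ => by ring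
  have h3 : quad (symMatrix A) h = (⟪A h, h⟫ + ⟪A h, h⟫) / 2 := by
    nth_rewrite 1 [h1]
    rw [h2, quad, ← Finset.sum_add_distrib, Finset.sum_div]
    refine Finset.sum_congr rfl fun i _ => ?_
    rw [← Finset.sum_add_distrib, Finset.sum_div]
    refine Finset.sum_congr rfl fun j _ => ?_
    simp only [symMatrix]
    ring
  rw [h3]; ring

lemma abs_symMatrix_le {A : EuclideanSpace ℝ (Fin n) →L[ℝ] EuclideanSpace ℝ (Fin n)} {b : ℝ}
    (hb : ∀ k, |⟪A k, k⟫| ≤ b * ‖k‖ ^ 2) (i j : Fin n) : |symMatrix A i j| ≤ 3 * b := by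
  have hsingle : ∀ (w : EuclideanSpace ℝ (Fin n)) (i : Fin n),
      ⟪w, EuclideanSpace.single i (1 : ℝ)⟫ = w i := by
    intro w i
    simp [EuclideanSpace.inner_single_right]
  have h1 := hb (EuclideanSpace.single i 1)
  have h2 := hb (EuclideanSpace.single j 1)
  have h3 := hb (EuclideanSpace.single i 1 + EuclideanSpace.single j 1)
  have h4 : ‖EuclideanSpace.single i (1 : ℝ) + EuclideanSpace.single j 1‖ ^ 2 ≤ 2 ^ 2 := by
    gcongr
    refine (norm_add_le _ _).trans ?_
    simp only [PiLp.norm_single, norm_one]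
    norm_num
  have hb0 : 0 ≤ b := by
    have := (abs_nonneg _).trans h1
    simpa using this
  have h5 := mul_le_mul_of_nonneg_left h4 hb0
  simp only [map_add, inner_add_right, hsingle, PiLp.add_apply, PiLp.norm_single,
    norm_one] at h1 h2 h3
  rw [abs_le] at *
  simp only [symMatrix]
  constructor <;> linarith [h1.1, h1.2, h2.1, h2.2, h3.1, h3.2]

lemma quad_add (A B : Matrix (Fin n) (Fin n) ℝ) (v : EuclideanSpace ℝ (Fin n)) :
    quad (A + B) v = quad A v + quad B v := by
  simp only [quad, Matrix.add_apply, add_mul, Finset.sum_add_distrib]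

lemma quad_neg (A : Matrix (Fin n) (Fin n) ℝ) (v : EuclideanSpace ℝ (Fin n)) :
    quad (-A) v = -quad A v := by
  simp only [quad, Matrix.neg_apply, neg_mul, Finset.sum_neg_distrib]

lemma quad_smul_one (t : ℝ) (v : EuclideanSpace ℝ (Fin n)) :
    quad (t • (1 : Matrix (Fin n) (Fin n) ℝ)) v = t * ‖v‖ ^ 2 := by
  simp only [quad, Matrix.smul_apply, Matrix.one_apply, smul_eq_mul, EuclideanSpace.norm_sq_eq,
    Real.norm_eq_abs, sq_abs, Finset.mul_sum]
  refine Finset.sum_congr rfl fun i _ => ?_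
  rw [Finset.sum_eq_single i (by intro j _ hj; simp [hj.symm]) (by simp)]
  simp only [if_true]
  ring

lemma posSemidef_of_quad_nonneg {P : Matrix (Fin n) (Fin n) ℝ} (hP : P.IsSymm)
    (h : ∀ v, 0 ≤ quad P v) : P.PosSemidef := by
  refine .of_dotProduct_mulVec_nonneg (by simpa [Matrix.IsHermitian, Matrix.IsSymm] using hP) fun x => ?_
  refine (h (WithLp.toLp 2 x)).trans_eq ?_
  simp only [quad, dotProduct, Matrix.mulVec, star_trivial, Finset.mul_sum]
  exact Finset.sum_congr rfl fun i _ => Finset.sum_congr rfl fun j _ => by ring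

lemma HasTaylorAt.upperContactJet {u : EuclideanSpace ℝ (Fin n) → ℝ}
    {x p : EuclideanSpace ℝ (Fin n)} {A : EuclideanSpace ℝ (Fin n) →L[ℝ] EuclideanSpace ℝ (Fin n)}
    (h : HasTaylorAt u x p A) {ε : ℝ} (hε : 0 < ε) :
    UpperContactJet u x p (symMatrix A + ε • 1) := by
  filter_upwards [h (ε / 2) (half_pos hε)] with y hy
  rw [quad_add, quad_symMatrix, quad_smul_one]
  linarith [(abs_le.1 hy).2]

end Matrices

/-- Near a local maximum of the sum of two quasi-convex functions there are upper contact jets of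
both, uniformly bounded, whose sums are almost below the zero jet. -/
lemma exists_upperContactJets_near_max {n : ℕ} {U : Set (EuclideanSpace ℝ (Fin n))}
    (hU : IsOpen U) {u v : EuclideanSpace ℝ (Fin n) → ℝ} {lam : ℝ} (hlam : 0 ≤ lam)
    (hu : QCOn lam U u) (hv : QCOn lam U v) (huc : ContinuousOn u U) (hvc : ContinuousOn v U)
    {x₀ : EuclideanSpace ℝ (Fin n)} (hx₀ : x₀ ∈ U)
    (hmax : IsLocalMax (fun x => u x + v x) x₀) :
    ∃ (p₀ : EuclideanSpace ℝ (Fin n)) (C : ℝ), ∀ ε : ℝ, 0 < ε → ε ≤ 1 →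
      ∃ x ∈ U, ∃ (p q : EuclideanSpace ℝ (Fin n)) (M N : Matrix (Fin n) (Fin n) ℝ),
        dist x x₀ ≤ ε ∧ dist p p₀ ≤ ε ∧ dist (-q) p₀ ≤ ε ∧ M.IsSymm ∧ N.IsSymm ∧
        UpperContactJet u x p M ∧ UpperContactJet v x q N ∧
        (∀ k, quad M k + quad N k ≤ ε * ‖k‖ ^ 2) ∧ ∀ i j, |M i j| ≤ C := by
  have hsub : ∀ {w : EuclideanSpace ℝ (Fin n) → ℝ}, QCOn lam U w →
      ∃ p : EuclideanSpace ℝ (Fin n) → EuclideanSpace ℝ (Fin n),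
        ∀ x ∈ U, IsSemiSubgradient (lam / 2) U w x (p x) := by
    intro w hw
    have : ∀ x, ∃ p, x ∈ U → IsSemiSubgradient (lam / 2) U w x p := by
      intro x
      by_cases hx : x ∈ U
      · obtain ⟨p, hp⟩ := exists_isSemiSubgradient hU hw hx
        exact ⟨p, fun _ => hp⟩
      · exact ⟨0, fun h => absurd h hx⟩
    choose p hp using this
    exact ⟨p, hp⟩
  obtain ⟨p, hp⟩ := hsub hu
  obtain ⟨q, hq⟩ := hsub hv
  obtain ⟨R, hR, hball⟩ := Metric.nhds_basis_closedBall.mem_iff.1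
    (inter_mem (hU.mem_nhds hx₀) hmax)
  refine ⟨p x₀, 3 * (lam + 1) + 1, fun ε hε hε1 => ?_⟩
  have hL : 0 < 14 * (lam / 2) + 9 := by positivity
  obtain ⟨r, hr, hrR, hrε, hrL⟩ : ∃ r : ℝ, 0 < r ∧ r ≤ R ∧ r ≤ ε ∧
      (14 * (lam / 2) + 9) * r ≤ ε := by
    refine ⟨min R (min ε (ε / (14 * (lam / 2) + 9))), by positivity, min_le_left _ _,
      (min_le_right _ _).trans (min_le_left _ _), ?_⟩
    rw [← le_div_iff₀' hL]
    exact (min_le_right _ _).trans (min_le_right _ _)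
  have hsubset : Metric.closedBall x₀ r ⊆ Metric.closedBall x₀ R :=
    Metric.closedBall_subset_closedBall hrR
  have hSU : Metric.closedBall x₀ r ⊆ U := fun y hy => (hball (hsubset hy)).1
  obtain ⟨x, hx, A, B, hTu, hTv, hpx, hqx, hAB, hA, hB⟩ :=
    exists_hasTaylorAt_near_max (c := lam / 2) (δ := ε / 4) (by positivity) hr (by positivity)
      (by linarith) (huc.mono hSU) (hvc.mono hSU)
      (fun w hw => (hp w (hSU hw)).mono hSU) (fun w hw => (hq w (hSU hw)).mono hSU)
      (fun y hy => (hball (hsubset hy)).2)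
  rw [mem_ball_iff_norm] at hx
  have hxr : (14 * (lam / 2) + 9) * ‖x - x₀‖ ≤ ε :=
    le_trans (by gcongr; linarith) hrL
  have hxS : x ∈ Metric.closedBall x₀ r := by
    rw [mem_closedBall_iff_norm]; linarith
  have hsymm : ∀ D : EuclideanSpace ℝ (Fin n) →L[ℝ] EuclideanSpace ℝ (Fin n),
      (symMatrix D + (ε / 4) • 1).IsSymm := fun D =>
    (isSymm_symMatrix D).add ((Matrix.isSymm_one).smul _)
  refine ⟨x, hSU hxS, p x, q x, symMatrix A + (ε / 4) • 1, symMatrix B + (ε / 4) • 1, ?_, ?_, ?_,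
    hsymm A, hsymm B, hTu.upperContactJet (by positivity), hTv.upperContactJet (by positivity),
    fun k => ?_, fun i j => ?_⟩
  · rw [dist_eq_norm]; linarith
  · rw [dist_eq_norm]; linarith
  · rw [dist_eq_norm, ← norm_neg, neg_sub, sub_neg_eq_add, add_comm]; linarith
  · rw [quad_add, quad_add, quad_symMatrix, quad_symMatrix, quad_smul_one]
    linarith [hAB k]
  · have h1 := abs_symMatrix_le (A := A) (b := lam + 1) (fun k => by
      have := hAB k
      have := hA k
      have := hB k
      have h2 : 0 ≤ ‖k‖ ^ 2 := by positivity
      rw [abs_le]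
      constructor <;> nlinarith) i j
    have h2 : |((ε / 4) • (1 : Matrix (Fin n) (Fin n) ℝ)) i j| ≤ 1 := by
      rw [Matrix.smul_apply, Matrix.one_apply, smul_eq_mul]
      split_ifs
      · rw [mul_one, abs_of_nonneg (by positivity)]; linarith
      · simp
    rw [Matrix.add_apply]
    exact (abs_add_le _ _).trans (by linarith)

/-- (Strict Comparison) Let `F, G` be primitive subequations on `U` with `G ⊆ Int F`, where
`Int F` satisfies positivity and negativity. If `u` is `G`-subharmonic, `v` is
`F̃`-subharmonic (dual subequation), and both are quasi-convex, then the zero maximum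
principle holds for `u + v` on any compact `K ⊆ U`. -/
theorem stmt_19 {n : ℕ} (F G : Set (Jet n))
    (hFc : IsClosed F) (hFp : Positivity F) (hGc : IsClosed G) (hGp : Positivity G)
    (hGF : G ⊆ interior F)
    (hIntP : Positivity (interior F))
    (hIntN : ∀ (x : EuclideanSpace ℝ (Fin n)) (r s : ℝ) (p : EuclideanSpace ℝ (Fin n))
      (A : Matrix (Fin n) (Fin n) ℝ),
        (x, r, p, A) ∈ interior F → s ≤ r → (x, s, p, A) ∈ interior F)
    (U : Set (EuclideanSpace ℝ (Fin n))) (hU : IsOpen U)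
    (u v : EuclideanSpace ℝ (Fin n) → ℝ) (lam : ℝ) (hlam : 0 ≤ lam)
    (hqcu : QCOn lam U u) (hqcv : QCOn lam U v)
    (hu : Subharm G U u)
    (hv : Subharm {z : Jet n | (z.1, -z.2.1, -z.2.2.1, -z.2.2.2) ∉ F} U v)
    (K : Set (EuclideanSpace ℝ (Fin n))) (hK : IsCompact K) (hKU : K ⊆ U)
    (hbd : ∀ x ∈ frontier K, u x + v x ≤ 0) :
    ∀ x ∈ K, u x + v x ≤ 0 := by
  intro x₁ hx₁
  by_contra! hpos
  have hcont : ∀ {w : EuclideanSpace ℝ (Fin n) → ℝ}, QCOn lam U w → ContinuousOn w U := by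
    intro w hw
    have h1 : ContinuousOn (fun x => w x + (lam / 2) * ‖x‖ ^ 2) U := ConvexOn.continuousOn hU hw
    have h2 : ContinuousOn (fun x => w x + (lam / 2) * ‖x‖ ^ 2 - (lam / 2) * ‖x‖ ^ 2) U :=
      h1.sub (by fun_prop)
    simpa using h2
  have huc := hcont hqcu
  have hvc := hcont hqcv
  obtain ⟨x₀, hx₀K, hx₀⟩ := hK.exists_isMaxOn ⟨x₁, hx₁⟩ ((huc.add hvc).mono hKU)
  have hM : 0 < u x₀ + v x₀ := lt_of_lt_of_le hpos (hx₀ hx₁)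
  have hint : x₀ ∈ interior K := by
    by_contra hni
    exact hM.not_ge (hbd x₀ ⟨subset_closure hx₀K, hni⟩)
  have hmax : IsLocalMax (fun x => u x + v x) x₀ := by
    filter_upwards [mem_interior_iff_mem_nhds.1 hint] with y hy using hx₀ hy
  have hx₀U := hKU hx₀K
  obtain ⟨p₀, C, hjets⟩ :=
    exists_upperContactJets_near_max hU hlam hqcu hqcv huc hvc hx₀U hmax
  have hseq : ∀ k : ℕ, 0 < 1 / ((k : ℝ) + 1) ∧ 1 / ((k : ℝ) + 1) ≤ 1 := fun k =>
    ⟨by positivity, by rw [div_le_one (by positivity)]; linarith [(Nat.cast_nonneg k : (0 : ℝ) ≤ k)]⟩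
  choose x hxU p q M N hx hp hq hMs hNs hMu hNv hMN hMC using fun k : ℕ =>
    hjets (1 / ((k : ℝ) + 1)) (hseq k).1 (hseq k).2
  let f : Ultrafilter ℕ := hyperfilter ℕ
  have hf : (f : Filter ℕ) ≤ atTop := by
    rw [← Nat.cofinite_eq_atTop]; exact hyperfilter_le_cofinite
  have hε : Tendsto (fun k : ℕ => 1 / ((k : ℝ) + 1)) f (𝓝 0) :=
    tendsto_one_div_add_atTop_nhds_zero_nat.mono_left hf
  have hlim : ∀ {w : ℕ → EuclideanSpace ℝ (Fin n)} {a : EuclideanSpace ℝ (Fin n)},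
      (∀ k, dist (w k) a ≤ 1 / ((k : ℝ) + 1)) → Tendsto w f (𝓝 a) := fun hw =>
    tendsto_iff_dist_tendsto_zero.2 (squeeze_zero (fun _ => dist_nonneg) hw hε)
  have hxlim := hlim hx
  have hplim := hlim hp
  have hqlim := hlim hq
  have hulim : Tendsto (fun k => u (x k)) f (𝓝 (u x₀)) :=
    (huc.continuousAt (hU.mem_nhds hx₀U)).tendsto.comp hxlim
  have hvlim : Tendsto (fun k => v (x k)) f (𝓝 (v x₀)) :=
    (hvc.continuousAt (hU.mem_nhds hx₀U)).tendsto.comp hxlim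
  obtain ⟨M₀, hMlim⟩ : ∃ M₀, Tendsto M f (𝓝 M₀) := by
    have hcompact : IsCompact {D : Matrix (Fin n) (Fin n) ℝ | ∀ i ∈ Set.univ,
        D i ∈ {d : Fin n → ℝ | ∀ j ∈ Set.univ, d j ∈ Set.Icc (-C) C}} :=
      isCompact_univ_pi fun _ => isCompact_univ_pi fun _ => isCompact_Icc
    obtain ⟨M₀, -, h⟩ := hcompact.ultrafilter_le_nhds (f.map M) (by
      rw [le_principal_iff, Ultrafilter.mem_coe, Ultrafilter.mem_map]
      exact Filter.mem_of_superset univ_mem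
        (fun k _ i _ j _ => abs_le.1 (hMC k i j)))
    exact ⟨M₀, h⟩
  have hG : (x₀, u x₀, p₀, M₀) ∈ G :=
    hGc.mem_of_tendsto (hxlim.prodMk_nhds (hulim.prodMk_nhds (hplim.prodMk_nhds hMlim)))
      (Eventually.of_forall fun k => hu (x k) (hxU k) (p k) (M k) (hMs k) (hMu k))
  have hF : (x₀, -v x₀, p₀, M₀) ∈ interior F := hIntN _ _ _ _ _ (hGF hG) (by linarith)
  have hMlim' : Tendsto (fun k : ℕ => M k - (1 / ((k : ℝ) + 1)) • (1 : Matrix (Fin n) (Fin n) ℝ))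
      f (𝓝 M₀) := by
    have := hMlim.sub (hε.smul_const (1 : Matrix (Fin n) (Fin n) ℝ))
    rwa [zero_smul, sub_zero] at this
  obtain ⟨k, hk⟩ := ((hxlim.prodMk_nhds (hvlim.neg.prodMk_nhds
    (hqlim.prodMk_nhds hMlim'))).eventually (isOpen_interior.mem_nhds hF)).exists
  set ε : ℝ := 1 / ((k : ℝ) + 1)
  have hpsd : (ε • (1 : Matrix (Fin n) (Fin n) ℝ) + -(M k + N k)).PosSemidef := by
    refine posSemidef_of_quad_nonneg
      ((Matrix.isSymm_one.smul _).add ((hMs k).add (hNs k)).neg) fun w => ?_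
    rw [quad_add, quad_neg, quad_add, quad_smul_one]
    linarith [hMN k w]
  have hmem := hIntP _ _ _ _ _ hk hpsd
  have heq : M k - ε • (1 : Matrix (Fin n) (Fin n) ℝ) + (ε • 1 + -(M k + N k)) = -N k := by
    abel
  rw [heq] at hmem
  exact hv (x k) (hxU k) (q k) (N k) (hNs k) (hNv k) (interior_subset hmem)
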